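/- Let the momentum recursion be m^{t+1} = (1−β) m^t + β G^{t+1} with 0 < β ≤ 1, where conditioned on the past, E[G^{t+1}] = g(u^{t+1}) for some (possibly biased relative to ∇F) vector g, and E[‖G^{t+1} − g(u^{t+1})‖²] ≤ C_Δ. If F is L_F-smooth and ‖w^{t+1} − w^t‖ ≤ η c_u ‖m^t‖, then E[‖∇F(w^{t+1}) − m^{t+1}‖²] ≤ (1−β) ‖∇F(w^t) − m^t‖² + (4η²c_u²L_F²/β)‖m^t‖² + 4β ‖∇F(w^{t+1}) − g(u^{t+1})‖² + β² C_Δ. -/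

import Mathlib

open MeasureTheory

theorem gtr_real_aux (β p q r : ℝ) (hβ0 : 0 < β) (hβ1 : β ≤ 1) (hq : 0 ≤ q) :
    ((1 - β) * p + ((1 - β) * q + β * r)) ^ 2
      ≤ (1 - β) * p ^ 2 + 4 * q ^ 2 / β + 4 * β * r ^ 2 := by
  have key : ∀ s : ℝ, ((1 - β) * p + s) ^ 2 ≤ (1 - β) * p ^ 2 + s ^ 2 / β := by
    intro s
    have h : (1 - β) * p ^ 2 + s ^ 2 / β - ((1 - β) * p + s) ^ 2
        = (1 - β) / β * (β * p - s) ^ 2 := by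
      field_simp
      ring
    have h2 : 0 ≤ (1 - β) / β * (β * p - s) ^ 2 :=
      mul_nonneg (div_nonneg (by linarith) hβ0.le) (sq_nonneg _)
    linarith
  have h1 := key ((1 - β) * q + β * r)
  have h2 : ((1 - β) * q + β * r) ^ 2 ≤ 4 * q ^ 2 + 4 * β ^ 2 * r ^ 2 := by
    have h3 : ((1 - β) * q) ^ 2 ≤ q ^ 2 := by
      apply pow_le_pow_left₀ (mul_nonneg (by linarith) hq)
      nlinarith
    nlinarith [sq_nonneg ((1 - β) * q - β * r), sq_nonneg q, sq_nonneg (β * r)]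
  have h4 : ((1 - β) * q + β * r) ^ 2 / β ≤ 4 * q ^ 2 / β + 4 * β * r ^ 2 := by
    have h5 : 4 * q ^ 2 / β + 4 * β * r ^ 2 = (4 * q ^ 2 + 4 * β ^ 2 * r ^ 2) / β := by
      field_simp
    rw [h5]
    gcongr
  linarith

/-- One-step recursion for the gradient tracking error `Φᵗ = ‖∇F(wᵗ) - mᵗ‖²` in the
Adam-style analysis: with the momentum update `m' = (1-β) m + β G`, a conditionally
unbiased estimator `G` of `g(u⁺)` with variance at most `C_Δ`, an `L_F`-smooth `F`, and
a parameter move bounded by `‖w⁺ - w‖ ≤ η c_u ‖m‖`, we get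
`E‖∇F(w⁺) - m'‖² ≤ (1-β) E‖∇F(w) - m‖² + (4η²c_u²L_F²/β) E‖m‖²
  + 4β E‖∇F(w⁺) - g(u⁺)‖² + β² C_Δ`. -/
theorem gradient_tracking_recursion
    {Ω : Type*} {m0 : MeasurableSpace Ω} (μ : Measure Ω) [IsProbabilityMeasure μ]
    (𝓕 : MeasurableSpace Ω) (h𝓕 : 𝓕 ≤ m0)
    (D : ℕ) (F : EuclideanSpace ℝ (Fin D) → ℝ)
    (L_F η c_u β CΔ : ℝ) (hβ0 : 0 < β) (hβ1 : β ≤ 1) (hη : 0 ≤ η) (hcu : 0 ≤ c_u)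
    (hLF : 0 ≤ L_F) (hCΔ : 0 ≤ CΔ)
    (hdiff : Differentiable ℝ F)
    (hsmooth : ∀ x y, ‖gradient F x - gradient F y‖ ≤ L_F * ‖x - y‖)
    (w wnext mm gval G m' : Ω → EuclideanSpace ℝ (Fin D))
    (hw : StronglyMeasurable[𝓕] w) (hwnext : StronglyMeasurable[𝓕] wnext)
    (hmm : StronglyMeasurable[𝓕] mm) (hgval : StronglyMeasurable[𝓕] gval)
    (hGint : Integrable G μ)
    (hunbiased : μ[G | 𝓕] =ᵐ[μ] gval)
    (hvar : ∫ ω, ‖G ω - gval ω‖ ^ 2 ∂μ ≤ CΔ)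
    (hdrift : ∀ ω, ‖wnext ω - w ω‖ ≤ η * c_u * ‖mm ω‖)
    (hm' : ∀ ω, m' ω = (1 - β) • mm ω + β • G ω)
    (hint1 : Integrable (fun ω => ‖gradient F (w ω) - mm ω‖ ^ 2) μ)
    (hint2 : Integrable (fun ω => ‖mm ω‖ ^ 2) μ)
    (hint3 : Integrable (fun ω => ‖gradient F (wnext ω) - gval ω‖ ^ 2) μ)
    (hint4 : Integrable (fun ω => ‖gradient F (wnext ω) - m' ω‖ ^ 2) μ)
    (hint5 : Integrable (fun ω => ‖G ω - gval ω‖ ^ 2) μ) :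
    ∫ ω, ‖gradient F (wnext ω) - m' ω‖ ^ 2 ∂μ ≤
      (1 - β) * ∫ ω, ‖gradient F (w ω) - mm ω‖ ^ 2 ∂μ
        + (4 * η ^ 2 * c_u ^ 2 * L_F ^ 2 / β) * ∫ ω, ‖mm ω‖ ^ 2 ∂μ
        + 4 * β * ∫ ω, ‖gradient F (wnext ω) - gval ω‖ ^ 2 ∂μ
        + β ^ 2 * CΔ := by
  have hgc : Continuous (gradient F) := by
    have hl : LipschitzWith (Real.toNNReal L_F) (gradient F) := by
      apply LipschitzWith.of_dist_le_mul
      intro x y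
      rw [dist_eq_norm, dist_eq_norm, Real.coe_toNNReal _ hLF]
      exact hsmooth x y
    exact hl.continuous
  set A : Ω → EuclideanSpace ℝ (Fin D) := fun ω =>
    (1 - β) • (gradient F (wnext ω) - mm ω) + β • (gradient F (wnext ω) - gval ω) with hA
  set N : Ω → EuclideanSpace ℝ (Fin D) := fun ω => G ω - gval ω with hN
  have hgw : StronglyMeasurable[𝓕] (fun ω => gradient F (wnext ω)) :=
    hgc.comp_stronglyMeasurable hwnext
  have hAm : StronglyMeasurable[𝓕] A :=
    ((hgw.sub hmm).const_smul (1 - β)).add ((hgw.sub hgval).const_smul β)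
  have hgi : Integrable gval μ := (integrable_congr hunbiased).1 integrable_condExp
  have hNi : Integrable N μ := hGint.sub hgi
  have hX : ∀ ω, gradient F (wnext ω) - m' ω = A ω - β • N ω := by
    intro ω
    rw [hm' ω]
    simp only [hA, hN]
    module
  have hXm : AEStronglyMeasurable[m0] (fun ω => gradient F (wnext ω) - m' ω) μ := by
    simp_rw [hX]
    exact (hAm.mono h𝓕).aestronglyMeasurable.sub (hNi.aestronglyMeasurable.const_smul β)
  have hXL : MemLp (fun ω => gradient F (wnext ω) - m' ω) 2 μ :=
    (memLp_two_iff_integrable_sq_norm hXm).2 hint4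
  have hNL : MemLp N 2 μ :=
    (memLp_two_iff_integrable_sq_norm hNi.aestronglyMeasurable).2 hint5
  have hAL : MemLp A 2 μ := by
    have h := hXL.add (hNL.const_smul β)
    refine h.ae_eq (Filter.Eventually.of_forall fun ω => ?_)
    simp [hX]
  have hA2 : Integrable (fun ω => ‖A ω‖ ^ 2) μ :=
    (memLp_two_iff_integrable_sq_norm hAL.1).1 hAL
  have hAN : Integrable (fun ω => innerSL ℝ (A ω) (N ω)) μ := by
    refine (hA2.add hint5).mono' (hAL.1.inner hNL.1) (Filter.Eventually.of_forall fun ω => ?_)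
    have h := norm_inner_le_norm (𝕜 := ℝ) (A ω) (N ω)
    simp only [innerSL_apply_apply, Pi.add_apply]
    change _ ≤ ‖A ω‖ ^ 2 + ‖N ω‖ ^ 2
    nlinarith [sq_nonneg (‖A ω‖ - ‖N ω‖), sq_nonneg ‖A ω‖, sq_nonneg ‖N ω‖]
  have hcN : μ[N | 𝓕] =ᵐ[μ] 0 := by
    have h1 : μ[N | 𝓕] =ᵐ[μ] μ[G | 𝓕] - μ[gval | 𝓕] := condExp_sub hGint hgi 𝓕
    rw [condExp_of_stronglyMeasurable h𝓕 hgval hgi] at h1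
    filter_upwards [h1, hunbiased] with ω a b
    simp [a, b]
  have hcross : ∫ ω, innerSL ℝ (A ω) (N ω) ∂μ = 0 := by
    rw [← integral_condExp h𝓕]
    have h := condExp_bilin_of_stronglyMeasurable_left (innerSL ℝ) hAm hAN hNi
    apply integral_eq_zero_of_ae
    filter_upwards [h, hcN] with ω a b
    rw [a, b]
    simp
  have hexp : ∫ ω, ‖gradient F (wnext ω) - m' ω‖ ^ 2 ∂μ
      = ∫ ω, ‖A ω‖ ^ 2 ∂μ + β ^ 2 * ∫ ω, ‖N ω‖ ^ 2 ∂μ := by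
    have h : ∀ ω, ‖gradient F (wnext ω) - m' ω‖ ^ 2
        = (‖A ω‖ ^ 2 + β ^ 2 * ‖N ω‖ ^ 2) - 2 * β * innerSL ℝ (A ω) (N ω) := by
      intro ω
      rw [hX, norm_sub_sq_real, norm_smul, inner_smul_right, innerSL_apply_apply, mul_pow,
        Real.norm_eq_abs, sq_abs]
      ring
    simp_rw [h]
    have j1 : Integrable (fun ω => β ^ 2 * ‖N ω‖ ^ 2) μ := hint5.const_mul _
    have j2 : Integrable (fun ω => ‖A ω‖ ^ 2 + β ^ 2 * ‖N ω‖ ^ 2) μ := hA2.add j1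
    rw [integral_sub j2 (hAN.const_mul _),
      integral_add hA2 j1, integral_const_mul, integral_const_mul, hcross]
    ring
  have hpt : ∀ ω, ‖A ω‖ ^ 2 ≤ (1 - β) * ‖gradient F (w ω) - mm ω‖ ^ 2
      + (4 * η ^ 2 * c_u ^ 2 * L_F ^ 2 / β) * ‖mm ω‖ ^ 2
      + 4 * β * ‖gradient F (wnext ω) - gval ω‖ ^ 2 := by
    intro ω
    have hd : ‖gradient F (wnext ω) - gradient F (w ω)‖ ≤ L_F * (η * c_u * ‖mm ω‖) :=
      (hsmooth _ _).trans (mul_le_mul_of_nonneg_left (hdrift ω) hLF)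
    have hdec : A ω = (1 - β) • (gradient F (w ω) - mm ω)
        + ((1 - β) • (gradient F (wnext ω) - gradient F (w ω))
          + β • (gradient F (wnext ω) - gval ω)) := by
      simp only [hA]
      module
    have hb : 0 ≤ 1 - β := by linarith
    have hn : ‖A ω‖ ≤ (1 - β) * ‖gradient F (w ω) - mm ω‖
        + ((1 - β) * (L_F * (η * c_u * ‖mm ω‖)) + β * ‖gradient F (wnext ω) - gval ω‖) := by
      rw [hdec]
      refine (norm_add_le _ _).trans (add_le_add ?_ ((norm_add_le _ _).trans (add_le_add ?_ ?_)))
      · rw [norm_smul, Real.norm_of_nonneg hb]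
      · rw [norm_smul, Real.norm_of_nonneg hb]
        exact mul_le_mul_of_nonneg_left hd hb
      · rw [norm_smul, Real.norm_of_nonneg hβ0.le]
    have h1 := pow_le_pow_left₀ (norm_nonneg _) hn 2
    refine (h1.trans (gtr_real_aux β _ _ _ hβ0 hβ1 (by positivity))).trans (le_of_eq ?_)
    ring
  have hI : ∫ ω, ‖A ω‖ ^ 2 ∂μ ≤ (1 - β) * ∫ ω, ‖gradient F (w ω) - mm ω‖ ^ 2 ∂μ
        + (4 * η ^ 2 * c_u ^ 2 * L_F ^ 2 / β) * ∫ ω, ‖mm ω‖ ^ 2 ∂μ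
        + 4 * β * ∫ ω, ‖gradient F (wnext ω) - gval ω‖ ^ 2 ∂μ := by
    have i1 := hint1.const_mul (1 - β)
    have i2 := hint2.const_mul (4 * η ^ 2 * c_u ^ 2 * L_F ^ 2 / β)
    have i3 := hint3.const_mul (4 * β)
    have h := integral_mono hA2 ((i1.add i2).add i3) hpt
    refine h.trans (le_of_eq ?_)
    rw [← integral_const_mul, ← integral_const_mul, ← integral_const_mul,
      ← integral_add i1 i2]
    exact integral_add (i1.add i2) i3
  rw [hexp]
  have hv := mul_le_mul_of_nonneg_left hvar (sq_nonneg β)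
  exact add_le_add hI hv
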